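/- Let d be a positive integer and let X_1, X_2, …, X_{2d} be sets in ℝ^d such that B_1(0) ⊆ conv(X_i) for every i = 1, …, 2d. Then one can choose points x_1 ∈ X_1, x_2 ∈ X_2, …, x_{2d} ∈ X_{2d} such that B_r(0) ⊆ conv{x_1, x_2, …, x_{2d}}, where r = (π/e²)·d^{−2d−2}. -/

import Mathlib

section Conic

variable {ι E : Type*}

/-- A nonnegative combination of linearly dependent vectors can be rewritten with one coefficient
equal to zero. -/
theorem exists_nonneg_combination_eq_zero_of_not_linearIndepOn [AddCommGroup E] [Module ℝ E]
    {z : ι → E} {s : Finset ι} (hs : ¬ LinearIndepOn ℝ z (s : Set ι))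
    {c : ι → ℝ} (hc : ∀ i, 0 ≤ c i) :
    ∃ i ∈ s, ∃ c' : ι → ℝ, (∀ j, 0 ≤ c' j) ∧ c' i = 0 ∧
      ∑ j ∈ s, c' j • z j = ∑ j ∈ s, c j • z j := by
  classical
  obtain ⟨f, hf, i₀, hi₀, hne⟩ := not_linearIndepOn_finset_iff.1 hs
  obtain ⟨b, hb, hpos⟩ : ∃ b : ι → ℝ, ∑ j ∈ s, b j • z j = 0 ∧ ∃ i ∈ s, 0 < b i := by
    rcases lt_or_gt_of_ne hne with h | h
    · exact ⟨fun j => - f j, by simp [hf], i₀, hi₀, by simpa using h⟩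
    · exact ⟨f, hf, i₀, hi₀, h⟩
  obtain ⟨i, hi, hmin⟩ := Finset.exists_min_image (s.filter fun i => 0 < b i)
    (fun i => c i / b i) (by obtain ⟨i, hi, h⟩ := hpos; exact ⟨i, by simp [hi, h]⟩)
  simp only [Finset.mem_filter] at hi hmin
  refine ⟨i, hi.1, fun j => if j ∈ s then c j - c i / b i * b j else 0, fun j => ?_, ?_, ?_⟩
  · dsimp only
    split_ifs with hj
    · rcases lt_or_ge 0 (b j) with h | h
      · have := (le_div_iff₀ h).1 (hmin j ⟨hj, h⟩)
        linarith
      · have := mul_nonpos_of_nonneg_of_nonpos (div_nonneg (hc i) hi.2.le) h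
        linarith [hc j]
    · exact le_rfl
  · simp [hi.1, hi.2.ne']
  · rw [Finset.sum_congr rfl (g := fun j => c j • z j - (c i / b i) • (b j • z j))]
    · rw [Finset.sum_sub_distrib, ← Finset.smul_sum, hb, smul_zero, sub_zero]
    · intro j hj
      simp [hj, sub_smul, mul_smul]

/-- Finitely generated convex cones are closed. -/
theorem isClosed_nonneg_combinations [NormedAddCommGroup E] [NormedSpace ℝ E]
    (z : ι → E) (s : Finset ι) :
    IsClosed {v | ∃ c : ι → ℝ, (∀ i, 0 ≤ c i) ∧ ∑ i ∈ s, c i • z i = v} := by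
  classical
  induction s using Finset.strongInduction with
  | H s ih =>
    by_cases hs : LinearIndepOn ℝ z (s : Set ι)
    · have hinj : LinearMap.ker (Fintype.linearCombination ℝ (fun i : s => z i)) = ⊥ :=
        LinearMap.ker_eq_bot.2 (hs.fintypeLinearCombination_injective)
      have := (LinearMap.isClosedEmbedding_of_injective hinj).isClosedMap _
        (isClosed_Ici (a := (0 : s → ℝ)))
      convert this using 1
      ext v
      constructor
      · rintro ⟨c, hc, rfl⟩
        refine ⟨fun i => c i, fun i => hc i, ?_⟩
        rw [Fintype.linearCombination_apply, ← Finset.sum_coe_sort s]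
      · rintro ⟨c, hc, rfl⟩
        refine ⟨fun i => if h : i ∈ s then c ⟨i, h⟩ else 0, fun i => ?_, ?_⟩
        · dsimp only
          split_ifs with h
          · exact hc _
          · exact le_rfl
        · rw [Fintype.linearCombination_apply, ← Finset.sum_coe_sort s]
          simp
    · have : {v | ∃ c : ι → ℝ, (∀ i, 0 ≤ c i) ∧ ∑ i ∈ s, c i • z i = v} =
          ⋃ i ∈ s, {v | ∃ c : ι → ℝ, (∀ i, 0 ≤ c i) ∧ ∑ j ∈ s.erase i, c j • z j = v} := by
        ext v
        simp only [Set.mem_iUnion]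
        constructor
        · rintro ⟨c, hc, rfl⟩
          obtain ⟨i, hi, c', hc', h0, h⟩ :=
            exists_nonneg_combination_eq_zero_of_not_linearIndepOn hs hc
          refine ⟨i, hi, c', hc', ?_⟩
          rw [← h, ← Finset.add_sum_erase s _ hi, h0, zero_smul, zero_add]
        · rintro ⟨i, hi, c, hc, rfl⟩
          refine ⟨Function.update c i 0, fun j => ?_, ?_⟩
          · by_cases h : j = i
            · subst h; simp
            · simp [h, hc]
          · rw [← Finset.add_sum_erase s _ hi]
            simp only [Function.update_self, zero_smul, zero_add]
            refine Finset.sum_congr rfl fun j hj => ?_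
            rw [Function.update_of_ne (Finset.ne_of_mem_erase hj)]
      rw [this]
      exact s.finite_toSet.isClosed_biUnion fun i hi => ih _ (Finset.erase_ssubset hi)

variable [NormedAddCommGroup E] [InnerProductSpace ℝ E] [FiniteDimensional ℝ E]

open scoped RealInnerProductSpace

/-- **Colorful Carathéodory theorem**, conic version. The hypothesis `h` says that `a` lies in the
convex cone generated by each of the `Z i`. -/
theorem colorful_caratheodory_cone [Fintype ι] (hcard : Fintype.card ι = Module.finrank ℝ E)
    (Z : ι → Finset E) (hne : ∀ i, (Z i).Nonempty) (a : E)
    (h : ∀ i, ∀ u : E, 0 < ⟪u, a⟫ → ∃ z ∈ Z i, 0 < ⟪u, z⟫) :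
    ∃ z : ι → E, (∀ i, z i ∈ Z i) ∧
      ∃ c : ι → ℝ, (∀ i, 0 ≤ c i) ∧ ∑ i, c i • z i = a := by
  classical
  let K : (ι → E) → Set E := fun z => {v | ∃ c : ι → ℝ, (∀ i, 0 ≤ c i) ∧ ∑ i, c i • z i = v}
  have hKz : ∀ z, (0 : E) ∈ K z := fun z => ⟨0, by simp, by simp⟩
  obtain ⟨z, hz, hmin⟩ := Finset.exists_min_image (Fintype.piFinset Z)
    (fun z => Metric.infDist a (K z)) (Fintype.piFinset_nonempty.2 hne)
  rw [Fintype.mem_piFinset] at hz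
  refine ⟨z, hz, ?_⟩
  have hclosed : IsClosed (K z) := isClosed_nonneg_combinations z Finset.univ
  have hconv : Convex ℝ (K z) := by
    rintro _ ⟨c, hc, rfl⟩ _ ⟨c', hc', rfl⟩ s t hs ht -
    refine ⟨fun i => s * c i + t * c' i,
      fun i => add_nonneg (mul_nonneg hs (hc i)) (mul_nonneg ht (hc' i)), ?_⟩
    simp [add_smul, mul_smul, Finset.sum_add_distrib, Finset.smul_sum]
  obtain ⟨v, hv, hdist⟩ := hclosed.exists_infDist_eq_dist ⟨0, hKz z⟩ a
  have hproj : ∀ w ∈ K z, ⟪a - v, w - v⟫ ≤ 0 := by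
    rw [← norm_eq_iInf_iff_real_inner_le_zero hconv hv, ← dist_eq_norm, ← hdist,
      Metric.infDist_eq_iInf]
    simp only [dist_eq_norm]
  by_cases hu : a - v = 0
  · rw [sub_eq_zero.1 hu]; exact hv
  exfalso
  have huv : ⟪a - v, v⟫ = 0 := by
    have h1 := hproj 0 (hKz z)
    have h2 := hproj ((2 : ℝ) • v) (by
      obtain ⟨c, hc, hcv⟩ := hv
      refine ⟨fun i => 2 * c i, fun i => by have := hc i; positivity, ?_⟩
      rw [← hcv, Finset.smul_sum]
      simp only [mul_smul])
    have h3 : (2 : ℝ) • v - v = v := by rw [two_smul, add_sub_cancel_right]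
    rw [h3] at h2
    rw [zero_sub, inner_neg_right] at h1
    linarith
  have hle : ∀ i, ⟪a - v, z i⟫ ≤ 0 := fun i => by
    have := hproj (z i) ⟨fun j => if j = i then 1 else 0,
      fun j => by dsimp only; split_ifs <;> norm_num, by simp⟩
    rw [inner_sub_right, huv] at this
    linarith
  obtain ⟨i, c, hc, hci, hcv⟩ : ∃ i, ∃ c : ι → ℝ, (∀ j, 0 ≤ c j) ∧ c i = 0 ∧
      ∑ j, c j • z j = v := by
    obtain ⟨c, hc, hcv⟩ := hv
    by_cases h0 : ∃ i, c i = 0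
    · obtain ⟨i, hi⟩ := h0
      exact ⟨i, c, hc, hi, hcv⟩
    push Not at h0
    have hsum : ∑ i, c i * ⟪a - v, z i⟫ = 0 := by
      rw [← huv]
      conv_rhs => rw [← hcv, inner_sum]
      simp only [inner_smul_right]
      rw [hcv]
    have horth : ∀ i, ⟪a - v, z i⟫ = 0 := fun i => by
      have := (Finset.sum_eq_zero_iff_of_nonpos
        (fun i _ => mul_nonpos_of_nonneg_of_nonpos (hc i) (hle i))).1 hsum i (Finset.mem_univ i)
      exact (mul_eq_zero.1 this).resolve_left (h0 i)
    have hdep : ¬ LinearIndepOn ℝ z ((Finset.univ : Finset ι) : Set ι) := by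
      rw [Finset.coe_univ, linearIndepOn_univ_iff]
      intro hli
      have htop := hli.span_eq_top_of_card_eq_finrank' hcard
      apply hu
      have hmem : a - v ∈ Submodule.span ℝ (Set.range z) := htop ▸ Submodule.mem_top
      have : Submodule.span ℝ (Set.range z) ≤ LinearMap.ker (innerₛₗ ℝ (a - v)) := by
        rw [Submodule.span_le]
        rintro _ ⟨i, rfl⟩
        exact horth i
      exact inner_self_eq_zero.1 (this hmem)
    obtain ⟨i, -, c', hc', h0', h'⟩ :=
      exists_nonneg_combination_eq_zero_of_not_linearIndepOn hdep hc
    exact ⟨i, c', hc', h0', h'.trans hcv⟩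
  have hua : ⟪a - v, a⟫ = ⟪a - v, a - v⟫ := by rw [inner_sub_right _ a v, huv, sub_zero]
  obtain ⟨w, hw, hwpos⟩ := h i (a - v) (hua ▸ real_inner_self_pos.2 hu)
  have hw0 : 0 < ⟪w, w⟫ := real_inner_self_pos.2 (by rintro rfl; simp at hwpos)
  set ε : ℝ := ⟪a - v, w⟫ / ⟪w, w⟫ with hε
  have hmem : v + ε • w ∈ K (Function.update z i w) := by
    refine ⟨Function.update c i ε, fun j => ?_, ?_⟩
    · by_cases hj : j = i
      · subst hj; rw [Function.update_self]; positivity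
      · simp [hj, hc]
    · rw [← hcv, ← Finset.add_sum_erase _ _ (Finset.mem_univ i),
        ← Finset.add_sum_erase _ (fun j => c j • z j) (Finset.mem_univ i), hci]
      simp only [Function.update_self, zero_smul, zero_add]
      rw [add_comm]
      congr 1
      refine Finset.sum_congr rfl fun j hj => ?_
      rw [Function.update_of_ne (Finset.ne_of_mem_erase hj),
        Function.update_of_ne (Finset.ne_of_mem_erase hj)]
  have h1 : dist a v ≤ dist a (v + ε • w) := by
    rw [← hdist]
    refine (hmin (Function.update z i w) ?_).trans (Metric.infDist_le_dist_of_mem hmem)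
    rw [Fintype.mem_piFinset]
    intro j
    by_cases hj : j = i
    · subst hj; simpa using hw
    · simpa [hj] using hz j
  rw [dist_eq_norm, dist_eq_norm, ← sub_sub] at h1
  have h2 := pow_le_pow_left₀ (norm_nonneg _) h1 2
  rw [norm_sub_sq_real (a - v) (ε • w), inner_smul_right, norm_smul, mul_pow,
    ← real_inner_self_eq_norm_sq w, Real.norm_eq_abs, sq_abs] at h2
  have h3 : ε * ⟪w, w⟫ = ⟪a - v, w⟫ := by rw [hε]; field_simp
  have h4 : 0 < ε := by positivity
  nlinarith [mul_pos h4 hwpos]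

/-- **Colorful Carathéodory theorem** with one prescribed vertex at the origin. -/
theorem colorful_caratheodory_zero [Fintype ι] (hcard : Fintype.card ι = Module.finrank ℝ E)
    (Y : ι → Set E) (p : E) {μ : ℝ} (hμ : 1 < μ) (h : ∀ i, μ • p ∈ convexHull ℝ (Y i)) :
    ∃ y : ι → E, (∀ i, y i ∈ Y i) ∧
      ∃ c : ι → ℝ, (∀ i, 0 ≤ c i) ∧ ∑ i, c i ≤ 1 ∧ ∑ i, c i • y i = p := by
  classical
  have h' : ∀ i, ∃ t : Finset E, ↑t ⊆ Y i ∧ μ • p ∈ convexHull ℝ (t : Set E) := fun i => by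
    have := h i
    rw [convexHull_eq_union_convexHull_finite_subsets] at this
    simpa only [Set.mem_iUnion, exists_prop] using this
  choose T hTY hT using h'
  obtain ⟨z, hz, c, hc, hcz⟩ := colorful_caratheodory_cone hcard
    (fun i => (T i).image (fun y => y - p))
    (fun i => by
      have : (T i : Set E).Nonempty := convexHull_nonempty_iff.1 ⟨_, hT i⟩
      exact (Finset.coe_nonempty.1 this).image _)
    p (fun i u hu => by
      by_contra! hcon
      have hsub : (T i : Set E) ⊆ {y | ⟪u, y⟫ ≤ ⟪u, p⟫} := fun y hy => by
        have := hcon (y - p) (Finset.mem_image_of_mem _ hy)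
        rw [inner_sub_right] at this
        simpa using this
      have hcvx : Convex ℝ {y | ⟪u, y⟫ ≤ ⟪u, p⟫} :=
        convex_halfSpace_le (innerₛₗ ℝ u).isLinear _
      have := convexHull_min hsub hcvx (hT i)
      rw [Set.mem_ofPred_eq, inner_smul_right] at this
      nlinarith)
  have hS : 0 ≤ ∑ i, c i := Finset.sum_nonneg fun i _ => hc i
  refine ⟨fun i => z i + p, fun i => ?_, fun i => c i / (1 + ∑ i, c i),
    fun i => div_nonneg (hc i) (by linarith), ?_, ?_⟩
  · obtain ⟨y, hy, hyz⟩ := Finset.mem_image.1 (hz i)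
    simpa [← hyz] using hTY i hy
  · rw [← Finset.sum_div, div_le_one (by linarith)]
    linarith
  · have : ∀ i, (c i / (1 + ∑ i, c i)) • (z i + p) =
        (1 + ∑ i, c i)⁻¹ • (c i • z i + c i • p) := fun i => by
      rw [div_eq_inv_mul, mul_smul, smul_add]
    simp only [this]
    rw [← Finset.smul_sum, Finset.sum_add_distrib, hcz, ← Finset.sum_smul,
      inv_smul_eq_iff₀ (by linarith), add_smul, one_smul]

end Conic

section Core

open scoped RealInnerProductSpace

/-- Given `M` linear forms, each having a coefficient of absolute value at least `1`, at some point of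
the grid `{0, …, M}^ι` all of these forms have absolute value at least `1 / 2`. -/
theorem exists_grid_point_half_le_abs {ι κ : Type*} [Fintype ι] [Fintype κ]
    (n : κ → ι → ℝ) (hn : ∀ k, ∃ j, 1 ≤ |n k j|) :
    ∃ p : ι → Fin (Fintype.card κ + 1), ∀ k, 1 / 2 ≤ |∑ j, n k j * ((p j : ℕ) : ℝ)| := by
  classical
  by_contra! hcon
  set M := Fintype.card κ with hM
  let bad : κ → Finset (ι → Fin (M + 1)) := fun k =>
    Finset.univ.filter fun p => |∑ j, n k j * ((p j : ℕ) : ℝ)| < 1 / 2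
  have hbad : ∀ k, (bad k).card ≤ (M + 1) ^ (Fintype.card ι - 1) := fun k => by
    obtain ⟨i, hi⟩ := hn k
    have hcard : Fintype.card ({j // j ≠ i} → Fin (M + 1)) = (M + 1) ^ (Fintype.card ι - 1) := by
      rw [Fintype.card_fun, Fintype.card_fin, Fintype.card_subtype_compl,
        Fintype.card_subtype_eq]
    rw [← hcard, ← Finset.card_univ]
    refine Finset.card_le_card_of_injOn (fun p j => p j) (by simp) fun p hp q hq hpq => ?_
    simp only [bad, Finset.coe_filter, Finset.mem_univ, true_and, Set.mem_ofPred_eq] at hp hq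
    have hoff : ∀ j, j ≠ i → p j = q j := fun j hj => congrFun hpq ⟨j, hj⟩
    rw [← Finset.add_sum_erase _ _ (Finset.mem_univ i)] at hp hq
    rw [Finset.sum_congr rfl (g := fun j => n k j * ((q j : ℕ) : ℝ))
      (fun j hj => by rw [hoff j (Finset.ne_of_mem_erase hj)])] at hp
    have h1 : |n k i * (((p i : ℕ) : ℝ) - ((q i : ℕ) : ℝ))| < 1 := by
      rw [abs_lt] at hp hq ⊢
      constructor <;> linarith [hp.1, hp.2, hq.1, hq.2]
    rw [abs_mul] at h1
    have h2 : |((p i : ℕ) : ℝ) - ((q i : ℕ) : ℝ)| < 1 := by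
      nlinarith [abs_nonneg (((p i : ℕ) : ℝ) - ((q i : ℕ) : ℝ))]
    have h3 : p i = q i := by
      have : |((p i : ℕ) : ℤ) - ((q i : ℕ) : ℤ)| < 1 := by exact_mod_cast h2
      rw [Int.abs_lt_one_iff] at this
      exact Fin.ext (by omega)
    funext j
    by_cases hj : j = i
    · rw [hj, h3]
    · exact hoff j hj
  obtain ⟨k₀, -⟩ := hcon 0
  obtain ⟨i₀, -⟩ := hn k₀
  have hpos : 0 < Fintype.card ι := Fintype.card_pos_iff.2 ⟨i₀⟩
  have hcover : (Finset.univ : Finset (ι → Fin (M + 1))) ⊆ Finset.univ.biUnion bad := fun p _ => by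
    obtain ⟨k, hk⟩ := hcon p
    exact Finset.mem_biUnion.2 ⟨k, Finset.mem_univ k, by simpa [bad] using hk⟩
  have h1 := (Finset.card_le_card hcover).trans
    (Finset.card_biUnion_le_card_mul _ _ _ fun k _ => hbad k)
  rw [Finset.card_univ, Finset.card_univ, Fintype.card_fun, Fintype.card_fin, ← hM] at h1
  obtain ⟨m, hm⟩ := Nat.exists_eq_succ_of_ne_zero hpos.ne'
  rw [hm, pow_succ, Nat.succ_sub_one, mul_comm] at h1
  have h2 : 0 < (M + 1) ^ m := by positivity
  exact absurd (Nat.le_of_mul_le_mul_right h1 h2) (by omega)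

/-- Any `d - 1` vectors of `ℝ^d` have a common normal vector of sup norm `1`. -/
theorem exists_normal_sup_norm_one {d : ℕ} (i : Fin d) (y : Fin d → EuclideanSpace ℝ (Fin d)) :
    ∃ n : EuclideanSpace ℝ (Fin d), (∀ j, j ≠ i → ⟪n, y j⟫ = 0) ∧ (∀ j, |n j| ≤ 1) ∧
      ∃ j, |n j| = 1 := by
  classical
  set S := Submodule.span ℝ (Set.range fun j : {j // j ≠ i} => y j) with hS
  have hd : 0 < d := i.pos
  have hlt : Module.finrank ℝ S < d := by
    refine (finrank_range_le_card (R := ℝ) (fun j : {j // j ≠ i} => y j)).trans_lt ?_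
    rw [Fintype.card_subtype_compl, Fintype.card_subtype_eq, Fintype.card_fin]
    omega
  have hne : Sᗮ ≠ ⊥ := fun hbot => by
    rw [Submodule.orthogonal_eq_bot_iff] at hbot
    rw [hbot, finrank_top, finrank_euclideanSpace_fin] at hlt
    exact lt_irrefl _ hlt
  obtain ⟨m, hm, hm0⟩ := Submodule.exists_mem_ne_zero_of_ne_bot hne
  have : Nonempty (Fin d) := ⟨i⟩
  obtain ⟨j₀, hj₀⟩ := Finite.exists_max fun j => |m j|
  have hpos : 0 < |m j₀| := by
    rw [abs_pos]
    intro h0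
    apply hm0
    ext j
    have := hj₀ j
    rw [h0, abs_zero] at this
    simpa using this
  refine ⟨|m j₀|⁻¹ • m, fun j hj => ?_, fun j => ?_, j₀, ?_⟩
  · rw [real_inner_smul_left, real_inner_comm,
      (Submodule.mem_orthogonal _ _).1 hm (y j) (Submodule.subset_span ⟨⟨j, hj⟩, rfl⟩), mul_zero]
  · rw [PiLp.smul_apply, smul_eq_mul, abs_mul, abs_inv, abs_abs, inv_mul_le_iff₀ hpos, mul_one]
    exact hj₀ j
  · rw [PiLp.smul_apply, smul_eq_mul, abs_mul, abs_inv, abs_abs, inv_mul_cancel₀ hpos.ne']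

/-- If `0` is a nontrivial nonnegative combination of points, then every nonnegative combination
of them with total weight at most `1` lies in their convex hull. -/
theorem sum_smul_mem_convexHull_range {ι E : Type*} [Fintype ι] [AddCommGroup E] [Module ℝ E]
    (x : ι → E) {α β : ι → ℝ} (hα : ∀ i, 0 ≤ α i) (hα1 : ∑ i, α i ≤ 1)
    (hβ : ∀ i, 0 ≤ β i) (hβpos : 0 < ∑ i, β i) (hβx : ∑ i, β i • x i = 0) :
    ∑ i, α i • x i ∈ convexHull ℝ (Set.range x) := by
  refine mem_convexHull_of_exists_fintype (fun i => α i + (1 - ∑ i, α i) / (∑ i, β i) * β i) x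
    (fun i => add_nonneg (hα i) (mul_nonneg (div_nonneg (by linarith) hβpos.le) (hβ i))) ?_
    (fun i => ⟨i, rfl⟩) ?_
  · rw [Finset.sum_add_distrib, ← Finset.mul_sum, div_mul_cancel₀ _ hβpos.ne']
    ring
  · simp only [add_smul, mul_smul]
    rw [Finset.sum_add_distrib, ← Finset.smul_sum, hβx, smul_zero, add_zero]

/-- Coordinates with respect to a family `y` admitting a dual family `N`. -/
theorem exists_eq_sum_smul_of_dual {ι E : Type*} [Fintype ι] [NormedAddCommGroup E]
    [InnerProductSpace ℝ E] [FiniteDimensional ℝ E]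
    (hcard : Fintype.card ι = Module.finrank ℝ E)
    {y N : ι → E} (hN : ∀ i j, j ≠ i → ⟪N i, y j⟫ = 0) (hNy : ∀ i, ⟪N i, y i⟫ ≠ 0) (w : E) :
    ∃ b : ι → ℝ, ∑ i, b i • y i = w ∧ ∀ i, b i * ⟪N i, y i⟫ = ⟪N i, w⟫ := by
  classical
  have key : ∀ (b : ι → ℝ) (i : ι), ⟪N i, ∑ j, b j • y j⟫ = b i * ⟪N i, y i⟫ := fun b i => by
    rw [inner_sum, Finset.sum_eq_single i]
    · rw [inner_smul_right]
    · intro j _ hj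
      rw [inner_smul_right, hN i j hj, mul_zero]
    · simp
  have hli : LinearIndependent ℝ y := by
    rw [Fintype.linearIndependent_iff]
    intro b hb i
    have := key b i
    rw [hb, inner_zero_right] at this
    exact (mul_eq_zero.1 this.symm).resolve_right (hNy i)
  have htop := hli.span_eq_top_of_card_eq_finrank' hcard
  obtain ⟨b, hb⟩ := (Submodule.mem_span_range_iff_exists_fun ℝ).1
    (htop ▸ Submodule.mem_top : w ∈ Submodule.span ℝ (Set.range y))
  exact ⟨b, hb, fun i => by rw [← hb, key]⟩


/-- A convex set containing `0` contains all nonnegative combinations of its points with total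
weight at most `1`. -/
theorem Convex.sum_smul_mem_of_zero_mem {ι E : Type*} [Fintype ι] [AddCommGroup E] [Module ℝ E]
    {s : Set E} (hs : Convex ℝ s) (h0 : (0 : E) ∈ s) {x : ι → E} (hx : ∀ i, x i ∈ s)
    {v : ι → ℝ} (hv : ∀ i, 0 ≤ v i) (hv1 : ∑ i, v i ≤ 1) : ∑ i, v i • x i ∈ s := by
  have := hs.sum_mem (t := Finset.univ) (w := fun o : Option ι => o.elim (1 - ∑ i, v i) v)
    (z := fun o : Option ι => o.elim 0 x)
    (by rintro (_ | i) -; exacts [sub_nonneg.2 hv1, hv i])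
    (by simp [Fintype.sum_option])
    (by rintro (_ | i) -; exacts [h0, hx i])
  simpa [Fintype.sum_option] using this

/-- If the `d` sets `A i` have convex hulls containing the unit ball of `ℝ^d`, then some points
`y i ∈ A i` span a simplicial cone which is quantitatively fat around a point `p` of
`conv {0, y 1, …, y d}`. -/
theorem exists_fat_colorful_cone {d : ℕ} (hd : 0 < d)
    (A : Fin d → Set (EuclideanSpace ℝ (Fin d)))
    (hA : ∀ i, Metric.closedBall 0 1 ⊆ convexHull ℝ (A i)) :
    ∃ y : Fin d → EuclideanSpace ℝ (Fin d), (∀ i, y i ∈ A i) ∧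
      ∃ c : Fin d → ℝ, (∀ i, 0 < c i) ∧ ∑ i, c i ≤ 1 ∧
        ‖∑ i, c i • y i‖ ^ 2 * d ≤ 81 / 100 ∧
        ∀ w : EuclideanSpace ℝ (Fin d), ∃ b : Fin d → ℝ, ∑ i, b i • y i = w ∧
          ∀ i, |b i| * (9 / 20 / (d ^ (2 * d) * √d)) ≤ c i * ‖w‖ := by
  classical
  have hdR : (0 : ℝ) < d := by exact_mod_cast hd
  have hcard : Fintype.card (Fin d) = Module.finrank ℝ (EuclideanSpace ℝ (Fin d)) := by simp
  have hg : ∀ i j : Fin d, ∃ y : Fin d → EuclideanSpace ℝ (Fin d), (∀ k, y k ∈ A i) ∧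
      ∃ c : Fin d → ℝ, (∀ k, 0 ≤ c k) ∧ ∑ k, c k ≤ 1 ∧
        ∑ k, c k • y k = (19 / 20 : ℝ) • EuclideanSpace.single j (1 : ℝ) := fun i j => by
    refine colorful_caratheodory_zero hcard (fun _ => A i) _ (μ := 20 / 19) (by norm_num)
      fun _ => hA i ?_
    rw [smul_smul, mem_closedBall_zero_iff, norm_smul]
    norm_num
  choose g hgA q hq0 hq1 hq using hg
  let κ := Σ i : Fin d, ({j // j ≠ i} → Fin d × Fin d)
  have hκ : Fintype.card κ = d ^ (2 * d - 1) := by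
    simp only [κ, Fintype.card_sigma, Fintype.card_fun, Fintype.card_prod, Fintype.card_fin,
      Fintype.card_subtype_compl, Fintype.card_subtype_eq, Finset.sum_const, Finset.card_univ,
      smul_eq_mul]
    rw [← pow_two, ← pow_mul, ← pow_succ']
    congr 1
    omega
  have hn := fun k : κ => exists_normal_sup_norm_one k.1
    (fun j => if h : j ≠ k.1 then g j (k.2 ⟨j, h⟩).1 (k.2 ⟨j, h⟩).2 else 0)
  choose n hn_orth hn_le hn_eq using hn
  obtain ⟨P, hP⟩ := exists_grid_point_half_le_abs (fun k j => n k j)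
    fun k => (hn_eq k).imp fun j hj => hj.ge
  have hM : ((d : ℝ) ^ (2 * d - 1)) * d = d ^ (2 * d) := by
    rw [← pow_succ]
    congr 1
    omega
  set δ : ℝ := 9 / 10 / d ^ (2 * d) with hδ
  have hδpos : 0 < δ := by positivity
  set p : EuclideanSpace ℝ (Fin d) := WithLp.toLp 2 fun j => δ * ((P j : ℕ) : ℝ) with hp
  have hp0 : ∀ j, 0 ≤ p j := fun j => by simp only [hp]; positivity
  have hp1 : ∀ j, p j ≤ 9 / 10 / d := fun j => by
    have h1 : ((P j : ℕ) : ℝ) ≤ (d : ℝ) ^ (2 * d - 1) := by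
      have h2 : (P j : ℕ) ≤ d ^ (2 * d - 1) := by
        rw [← hκ]
        exact Nat.lt_succ_iff.1 (P j).2
      exact_mod_cast h2
    calc p j ≤ δ * (d : ℝ) ^ (2 * d - 1) := mul_le_mul_of_nonneg_left h1 hδpos.le
      _ = 9 / 10 / d := by
        rw [hδ, ← hM]
        field_simp
  have hpn : ∀ k, δ / 2 ≤ |⟪n k, p⟫| := fun k => by
    have h1 : ⟪n k, p⟫ = δ * ∑ j, n k j * ((P j : ℕ) : ℝ) := by
      rw [PiLp.inner_apply, Finset.mul_sum]
      refine Finset.sum_congr rfl fun j _ => ?_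
      simp [hp]
      ring
    rw [h1, abs_mul, abs_of_pos hδpos]
    have := mul_le_mul_of_nonneg_left (hP k) hδpos.le
    linarith
  have hnorm : ∀ k, ‖n k‖ ≤ √d := fun k => by
    rw [EuclideanSpace.norm_eq]
    refine Real.sqrt_le_sqrt ?_
    calc ∑ j, ‖n k j‖ ^ 2 ≤ ∑ j : Fin d, (1 : ℝ) :=
          Finset.sum_le_sum fun j _ => pow_le_one₀ (norm_nonneg _) (hn_le k j)
      _ = d := by simp
  have hYp : ∀ i, (19 / 18 : ℝ) • p ∈
      convexHull ℝ (insert 0 (Set.range fun a : Fin d × Fin d => g i a.1 a.2)) := fun i => by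
    have h0 : (0 : EuclideanSpace ℝ (Fin d)) ∈
        convexHull ℝ (insert 0 (Set.range fun a : Fin d × Fin d => g i a.1 a.2)) :=
      subset_convexHull ℝ _ (Set.mem_insert _ _)
    have hcvx := convex_convexHull ℝ (insert 0 (Set.range fun a : Fin d × Fin d => g i a.1 a.2))
    have he : ∀ j, (19 / 20 : ℝ) • EuclideanSpace.single j (1 : ℝ) ∈
        convexHull ℝ (insert 0 (Set.range fun a : Fin d × Fin d => g i a.1 a.2)) := fun j => by
      rw [← hq i j]
      exact hcvx.sum_smul_mem_of_zero_mem h0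
        (fun k => subset_convexHull ℝ _ (Set.mem_insert_of_mem _ ⟨(j, k), rfl⟩))
        (hq0 i j) (hq1 i j)
    have hrep : (19 / 18 : ℝ) • p =
        ∑ j, (10 / 9 * p j) • (19 / 20 : ℝ) • EuclideanSpace.single j (1 : ℝ) := by
      ext l
      simp [Finset.sum_apply, Pi.single_apply]
      ring
    rw [hrep]
    refine hcvx.sum_smul_mem_of_zero_mem h0 he (fun j => by have := hp0 j; positivity) ?_
    calc ∑ j, 10 / 9 * p j ≤ ∑ j : Fin d, 10 / 9 * (9 / 10 / (d : ℝ)) :=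
          Finset.sum_le_sum fun j _ => by linarith [hp1 j]
      _ = 1 := by
        simp
        field_simp
  obtain ⟨y, hy, c, hc, hc1, hcp⟩ := colorful_caratheodory_zero hcard _ p
    (by norm_num : (1 : ℝ) < 19 / 18) hYp
  have hσ : ∀ j, ∃ a : Fin d × Fin d, y j ≠ 0 → y j = g j a.1 a.2 := fun j => by
    rcases hy j with h | ⟨a, ha⟩
    · exact ⟨(j, j), fun h' => absurd h h'⟩
    · exact ⟨a, fun _ => ha.symm⟩
  choose σ hσ using hσ
  set N : Fin d → EuclideanSpace ℝ (Fin d) := fun i => n ⟨i, fun j => σ j⟩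
  have hNy : ∀ i j, j ≠ i → ⟪N i, y j⟫ = 0 := fun i j hj => by
    by_cases h0 : y j = 0
    · rw [h0, inner_zero_right]
    · have := hn_orth ⟨i, fun j => σ j⟩ j hj
      rw [dif_pos hj] at this
      rw [hσ j h0]
      exact this
  have hcN : ∀ i, c i * ⟪N i, y i⟫ = ⟪N i, p⟫ := fun i => by
    rw [← hcp, inner_sum, Finset.sum_eq_single i]
    · rw [inner_smul_right]
    · intro j _ hj
      rw [inner_smul_right, hNy i j hj, mul_zero]
    · simp
  have hNp : ∀ i, ⟪N i, p⟫ ≠ 0 := fun i h0 => by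
    have := hpn ⟨i, fun j => σ j⟩
    change δ / 2 ≤ |⟪N i, p⟫| at this
    rw [h0, abs_zero] at this
    linarith
  have hNyi : ∀ i, ⟪N i, y i⟫ ≠ 0 := fun i => right_ne_zero_of_mul (hcN i ▸ hNp i)
  refine ⟨y, fun i => ?_, c, fun i => ?_, hc1, ?_, fun w => ?_⟩
  · rw [hσ i fun h0 => hNyi i (by rw [h0, inner_zero_right])]
    exact hgA _ _ _
  · exact (hc i).lt_of_ne (left_ne_zero_of_mul (hcN i ▸ hNp i)).symm
  · rw [hcp, EuclideanSpace.norm_sq_eq]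
    have h1 : ∑ j, ‖p j‖ ^ 2 ≤ ∑ j : Fin d, (9 / 10 / (d : ℝ)) ^ 2 :=
      Finset.sum_le_sum fun j _ => by
        rw [Real.norm_of_nonneg (hp0 j)]
        exact pow_le_pow_left₀ (hp0 j) (hp1 j) 2
    refine (mul_le_mul_of_nonneg_right h1 hdR.le).trans (le_of_eq ?_)
    simp
    field_simp
    norm_num
  · obtain ⟨b, hb, hbN⟩ := exists_eq_sum_smul_of_dual hcard hNy hNyi w
    refine ⟨b, hb, fun i => ?_⟩
    have h1 : |b i| * (δ / 2) ≤ c i * ‖w‖ * √d := by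
      have h2 : |b i| * |⟪N i, p⟫| = c i * |⟪N i, w⟫| := by
        rw [← hcN, ← hbN, abs_mul, abs_mul, abs_of_nonneg (hc i)]
        ring
      have h3 : |⟪N i, w⟫| ≤ √d * ‖w‖ := (abs_real_inner_le_norm _ _).trans
        (mul_le_mul_of_nonneg_right (hnorm _) (norm_nonneg _))
      calc |b i| * (δ / 2) ≤ |b i| * |⟪N i, p⟫| :=
            mul_le_mul_of_nonneg_left (hpn _) (abs_nonneg _)
        _ = c i * |⟪N i, w⟫| := h2
        _ ≤ c i * (√d * ‖w‖) := mul_le_mul_of_nonneg_left h3 (hc i)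
        _ = c i * ‖w‖ * √d := by ring
    have hsd : 0 < √(d : ℝ) := Real.sqrt_pos.2 hdR
    have h4 : |b i| * (9 / 20 / (d ^ (2 * d) * √d)) = |b i| * (δ / 2) / √d := by
      rw [hδ]
      field_simp
      ring
    rw [h4, div_le_iff₀ hsd]
    exact h1

/-- Given two families of `d` sets in `ℝ^d` whose convex hulls contain the unit ball, one can
choose a point from each set so that the convex hull of these `2d` points contains a ball of
explicit radius around the origin. -/
theorem exists_colorful_ball_subset_convexHull {d : ℕ} (hd : 2 ≤ d)
    (A B : Fin d → Set (EuclideanSpace ℝ (Fin d)))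
    (hA : ∀ i, Metric.closedBall 0 1 ⊆ convexHull ℝ (A i))
    (hB : ∀ i, Metric.closedBall 0 1 ⊆ convexHull ℝ (B i))
    {r : ℝ} (hr : 11 / 4 * r ≤ 9 / 20 / (d ^ (2 * d) * √d)) :
    ∃ y z : Fin d → EuclideanSpace ℝ (Fin d), (∀ i, y i ∈ A i) ∧ (∀ i, z i ∈ B i) ∧
      Metric.closedBall 0 r ⊆ convexHull ℝ (Set.range (Sum.elim y z)) := by
  have hdR : (2 : ℝ) ≤ d := by exact_mod_cast hd
  have hcard : Fintype.card (Fin d) = Module.finrank ℝ (EuclideanSpace ℝ (Fin d)) := by simp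
  obtain ⟨y, hy, c, hc, hc1, hnorm, hfat⟩ := exists_fat_colorful_cone (by omega) A hA
  set p := ∑ i, c i • y i with hp
  obtain ⟨z, hz, a, ha, ha1, haz⟩ := colorful_caratheodory_zero hcard B ((-(4 / 3) : ℝ) • p)
    (μ := 11 / 10) (by norm_num) fun i => hB i (by
      rw [smul_smul, mem_closedBall_zero_iff, norm_smul, Real.norm_eq_abs,
        show |(11 / 10 * -(4 / 3) : ℝ)| = 22 / 15 by norm_num [abs_of_neg]]
      nlinarith [norm_nonneg p])
  refine ⟨y, z, hy, hz, fun w hw => ?_⟩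
  rw [mem_closedBall_zero_iff] at hw
  set τ : ℝ := 9 / 20 / (d ^ (2 * d) * √d) with hτ
  have hτpos : 0 < τ := by
    have : 0 < √(d : ℝ) := Real.sqrt_pos.2 (by linarith)
    positivity
  obtain ⟨b, hb, hbc⟩ := hfat w
  set θ : ℝ := r / τ with hθ
  have hr0 : 0 ≤ r := (norm_nonneg w).trans hw
  have hθ0 : 0 ≤ θ := by positivity
  have hθ1 : 11 / 4 * θ ≤ 1 := by
    rw [hθ, ← mul_div_assoc, div_le_one hτpos]
    exact hr
  have hbθ : ∀ i, |b i| ≤ θ * c i := fun i => by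
    rw [hθ, div_mul_eq_mul_div, le_div_iff₀ hτpos]
    linarith [hbc i, mul_le_mul_of_nonneg_left hw (hc i).le]
  have hsumb : ∑ i, b i ≤ θ * ∑ i, c i := by
    rw [Finset.mul_sum]
    exact Finset.sum_le_sum fun i _ => (le_abs_self _).trans (hbθ i)
  have hw_eq : w = ∑ i, (Sum.elim (fun i => b i + θ * c i) (fun i => 3 / 4 * θ * a i) i) •
      Sum.elim y z i := by
    rw [Fintype.sum_sum_type]
    simp only [Sum.elim_inl, Sum.elim_inr, add_smul, mul_smul, Finset.sum_add_distrib,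
      ← Finset.smul_sum, hb, haz, ← hp]
    module
  rw [hw_eq]
  have hcpos : 0 < ∑ i, c i := Finset.sum_pos (fun i _ => hc i) ⟨⟨0, by omega⟩, by simp⟩
  have ha0 : 0 ≤ ∑ i, a i := Finset.sum_nonneg fun i _ => ha i
  refine sum_smul_mem_convexHull_range (β := Sum.elim c fun i => 3 / 4 * a i) _ ?_ ?_ ?_ ?_ ?_
  · rintro (i | i)
    · have := (abs_le.1 (hbθ i)).1
      simp only [Sum.elim_inl]
      linarith
    · have := ha i
      simp only [Sum.elim_inr]
      positivity
  · rw [Fintype.sum_sum_type]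
    simp only [Sum.elim_inl, Sum.elim_inr, Finset.sum_add_distrib, ← Finset.mul_sum]
    nlinarith
  · rintro (i | i)
    · exact (hc i).le
    · have := ha i
      simp only [Sum.elim_inr]
      positivity
  · rw [Fintype.sum_sum_type]
    simp only [Sum.elim_inl, Sum.elim_inr, ← Finset.mul_sum]
    linarith
  · rw [Fintype.sum_sum_type]
    simp only [Sum.elim_inl, Sum.elim_inr, mul_smul, ← Finset.smul_sum, haz, ← hp]
    module

theorem pi_div_exp_one_sq_le : Real.pi / Real.exp 1 ^ 2 ≤ 4253 / 10000 := by
  have h1 := Real.pi_lt_d4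
  have h2 := Real.exp_one_gt_d9
  rw [div_le_iff₀ (by positivity)]
  nlinarith

end Core

/-- Colorful quantitative Steinitz theorem with containment of small balls (Lemma 2.6):
given `2d` sets whose convex hulls each contain the unit ball, one can choose one point
from each set so that the convex hull of the chosen points contains the ball of radius
`(π/e²)·d^(−2d−2)` around the origin. -/
theorem colorful_steinitz_small_balls
    (d : ℕ) (hd : 0 < d)
    (X : Fin (2 * d) → Set (EuclideanSpace ℝ (Fin d)))
    (hX : ∀ i, Metric.closedBall (0 : EuclideanSpace ℝ (Fin d)) 1 ⊆ convexHull ℝ (X i)) :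
    ∃ x : Fin (2 * d) → EuclideanSpace ℝ (Fin d),
      (∀ i, x i ∈ X i) ∧
      Metric.closedBall (0 : EuclideanSpace ℝ (Fin d))
          ((Real.pi / Real.exp 1 ^ 2) * (d : ℝ) ^ (-(2 * (d : ℤ)) - 2)) ⊆
        convexHull ℝ (Set.range x) := by
  have hconst := pi_div_exp_one_sq_le
  let e : Fin d ⊕ Fin d ≃ Fin (2 * d) := finSumFinEquiv.trans (finCongr (two_mul d).symm)
  suffices h : ∃ y z : Fin d → EuclideanSpace ℝ (Fin d),
      (∀ i, y i ∈ X (e (Sum.inl i))) ∧ (∀ i, z i ∈ X (e (Sum.inr i))) ∧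
      Metric.closedBall (0 : EuclideanSpace ℝ (Fin d))
          ((Real.pi / Real.exp 1 ^ 2) * (d : ℝ) ^ (-(2 * (d : ℤ)) - 2)) ⊆
        convexHull ℝ (Set.range (Sum.elim y z)) by
    obtain ⟨y, z, hy, hz, h⟩ := h
    refine ⟨Sum.elim y z ∘ e.symm, fun i => ?_, ?_⟩
    · obtain ⟨i | i, rfl⟩ := e.surjective i
      · simpa using hy i
      · simpa using hz i
    · rwa [e.symm.surjective.range_comp]
  rcases Nat.lt_or_ge 1 d with hd2 | hd1
  · refine exists_colorful_ball_subset_convexHull hd2 _ _ (fun i => hX _) (fun i => hX _) ?_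
    have hdR : (2 : ℝ) ≤ d := by exact_mod_cast hd2
    have hsd : 0 < √(d : ℝ) := Real.sqrt_pos.2 (by linarith)
    have hpow : (d : ℝ) ^ (-(2 * (d : ℤ)) - 2) = ((d : ℝ) ^ (2 * d) * d ^ 2)⁻¹ := by
      rw [← pow_add, ← zpow_natCast, ← zpow_neg]
      congr 1
      push_cast
      ring
    have hsqrt : 1.17 * √(d : ℝ) ≤ 9 / 20 * d ^ 2 := by
      refine abs_le_of_sq_le_sq' ?_ (by positivity) |>.2
      rw [mul_pow, Real.sq_sqrt (by linarith)]
      have : (8 : ℝ) ≤ d ^ 3 := by nlinarith [pow_le_pow_left₀ (by norm_num) hdR 3]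
      nlinarith
    rw [hpow, le_div_iff₀ (by positivity), mul_inv]
    have hD : (0 : ℝ) < d ^ (2 * d) := by positivity
    calc 11 / 4 * (Real.pi / Real.exp 1 ^ 2 * (((d : ℝ) ^ (2 * d))⁻¹ * ((d : ℝ) ^ 2)⁻¹)) *
          (d ^ (2 * d) * √d) = 11 / 4 * (Real.pi / Real.exp 1 ^ 2) * √d / d ^ 2 := by
          field_simp
      _ ≤ 9 / 20 := by
        rw [div_le_iff₀ (by positivity)]
        nlinarith
  · obtain rfl : d = 1 := by omega
    have hcoord : ∀ (s : ℝ), |s| = 1 → ∀ i, ∃ x ∈ X i, 1 ≤ s * x 0 := fun s hs i => by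
      by_contra! hcon
      have hcvx : Convex ℝ {x : EuclideanSpace ℝ (Fin 1) | s * x 0 < 1} :=
        convex_halfSpace_lt (f := fun x : EuclideanSpace ℝ (Fin 1) => s * x 0)
          ⟨fun x y => by simp [mul_add], fun c x => by simp; ring⟩ 1
      have h1 := convexHull_min (fun x hx => hcon x hx) hcvx
        (hX i (a := EuclideanSpace.single 0 s) (by simp [hs]))
      change s * _ < 1 at h1
      have h2 := abs_mul_abs_self s
      rw [hs] at h2
      simp at h1
      linarith
    obtain ⟨u, hu, hu1⟩ := hcoord 1 (by norm_num) (e (Sum.inl 0))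
    obtain ⟨v, hv, hv1⟩ := hcoord (-1) (by norm_num) (e (Sum.inr 0))
    refine ⟨fun _ => u, fun _ => v, fun i => ?_, fun i => ?_, fun w hw => ?_⟩
    · rwa [Subsingleton.elim i 0]
    · rwa [Subsingleton.elim i 0]
    rw [mem_closedBall_zero_iff, Nat.cast_one, one_zpow, mul_one] at hw
    have hw1 : |w 0| ≤ 1 := by
      have := PiLp.norm_apply_le w 0
      rw [Real.norm_eq_abs] at this
      linarith
    obtain ⟨hwl, hwr⟩ := abs_le.1 hw1
    refine segment_subset_convexHull (Set.mem_range_self (Sum.inr 0))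
      (Set.mem_range_self (Sum.inl 0)) ?_
    have huv : 0 < u 0 - v 0 := by linarith
    refine ⟨(u 0 - w 0) / (u 0 - v 0), (w 0 - v 0) / (u 0 - v 0),
      div_nonneg (by linarith) huv.le, div_nonneg (by linarith) huv.le, ?_, ?_⟩
    · field_simp
      ring
    · ext j
      rw [Subsingleton.elim j 0]
      simp
      field_simp
      ring
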